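/- arXiv:2504.16690 — 2 statements merged into one kernel-verified Lean document; each statement's English description precedes it below -/
import Mathlib

section
/- Call a category 𝒞 with finite limits and small colimits grouplike if for every small site (D,K) and every pair of functors P, Q : 𝒞 ⥤ Sheaf K (Type) preserving finite limits and small colimits, every natural transformation P ⟶ Q is an isomorphism. Let X = Sheaf J (Type) be a Grothendieck topos on a small site and let X be an object of X such that the unique morphism X ⟶ ⊤ to the terminal object is an epimorphism (so the etale projection from the slice topos X/X to X is surjective). If the slice category Over X is grouplike, then X is grouplike. -/
universe u

open CategoryTheory Limits

/-- A category `𝒞` is grouplike if for every small site `(D, K)` and every pair of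
functors `P Q : 𝒞 ⥤ Sheaf K (Type u)` preserving finite limits and small colimits, every
natural transformation `P ⟶ Q` is an isomorphism. -/
def Grouplike (𝒞 : Type*) [Category 𝒞] : Prop :=
  ∀ (D : Type u) (_ : SmallCategory D) (K : GrothendieckTopology D)
    (P Q : 𝒞 ⥤ Sheaf K (Type u)),
    Nonempty (PreservesFiniteLimits P) → Nonempty (PreservesColimitsOfSize.{u, u} P) →
    Nonempty (PreservesFiniteLimits Q) → Nonempty (PreservesColimitsOfSize.{u, u} Q) →
    ∀ τ : P ⟶ Q, IsIso τ


open Opposite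

theorem univ_type {J : Type u} [SmallCategory J] {F : J ⥤ Type u} (c : Cocone F)
    (hc : IsColimit c) : IsUniversalColimit c := by
  intro F' c' α f e _ hp
  have ex : ∀ (j : J) (x : c'.pt) (a : F.obj j), f x = c.ι.app j a →
      ∃ a' : F'.obj j, c'.ι.app j a' = x ∧ α.app j a' = a := fun j x a h => by
    obtain ⟨a', h1, h2⟩ := Types.exists_of_isPullback (hp j) x a h
    exact ⟨a', h1, h2⟩
  have un : ∀ (j : J) (a b : F'.obj j), c'.ι.app j a = c'.ι.app j b →
      α.app j a = α.app j b → a = b := fun j a b h1 h2 => Types.ext_of_isPullback (hp j) h1 h2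
  have nat : ∀ {j k : J} (g : j ⟶ k) (a), α.app k (F'.map g a) = F.map g (α.app j a) :=
    fun g a => NatTrans.naturality_apply α g a
  have cw : ∀ {j k : J} (g : j ⟶ k) (a), c.ι.app k (F.map g a) = c.ι.app j a :=
    fun g a => ConcreteCategory.congr_hom (c.w g) a
  have cw' : ∀ {j k : J} (g : j ⟶ k) (a), c'.ι.app k (F'.map g a) = c'.ι.app j a :=
    fun g a => ConcreteCategory.congr_hom (c'.w g) a
  have ee : ∀ j (a), c.ι.app j (α.app j a) = f (c'.ι.app j a) :=
    fun j a => ConcreteCategory.congr_hom (NatTrans.congr_app e j) a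
  have key : ∀ (t : Cocone F') (x : c'.pt), ∃! y : t.pt, ∀ j (a : F'.obj j),
      c'.ι.app j a = x → t.ι.app j a = y := by
    intro t x
    have tw : ∀ {j k : J} (g : j ⟶ k) (a), t.ι.app k (F'.map g a) = t.ι.app j a :=
      fun g a => ConcreteCategory.congr_hom (t.w g) a
    let r : Cocone F :=
      { pt := Set t.pt
        ι := { app := fun j => TypeCat.ofHom (fun (a : F.obj j) => ({y | ∃ a' : F'.obj j, α.app j a' = a ∧
                  c'.ι.app j a' = x ∧ t.ι.app j a' = y} : Set t.pt))
               naturality := by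
                intro j k g
                ext a
                change {y | ∃ a' : F'.obj k, α.app k a' = F.map g a ∧
                  c'.ι.app k a' = x ∧ t.ι.app k a' = y} = {y | ∃ a' : F'.obj j, α.app j a' = a ∧
                  c'.ι.app j a' = x ∧ t.ι.app j a' = y}
                ext y
                constructor
                · rintro ⟨b, h1, h2, h3⟩
                  obtain ⟨a', h4, h5⟩ := ex j x a (by rw [← h2, ← ee, h1, cw])
                  have hb : b = F'.map g a' := un k _ _ (by rw [cw', h4, h2]) (by rw [nat, h5, h1])
                  exact ⟨a', h5, h4, by rw [← h3, hb, tw]⟩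
                · rintro ⟨b, h1, h2, h3⟩
                  exact ⟨F'.map g b, by rw [nat, h1], by rw [cw', h2], by rw [tw, h3]⟩ } }
    have hd : ∀ j (a : F.obj j), hc.desc r (c.ι.app j a) = r.ι.app j a :=
      fun j a => ConcreteCategory.congr_hom (hc.fac r j) a
    obtain ⟨j, a, ha⟩ := Types.jointly_surjective_of_isColimit hc (f x)
    obtain ⟨a', h1, h2⟩ := ex j x a ha.symm
    refine ⟨t.ι.app j a', fun k b hb => ?_, fun y hy => (hy j a' h1).symm⟩
    have h3 : r.ι.app k (α.app k b) = r.ι.app j a := by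
      rw [← hd, ← hd, ee, hb, ha]
    have h4 : t.ι.app k b ∈ (show Set t.pt from r.ι.app k (α.app k b)) := ⟨b, rfl, hb, rfl⟩
    rw [h3] at h4
    obtain ⟨a'', h5, h6, h7⟩ := h4
    rw [← h7, un j a'' a' (h6.trans h1.symm) (h5.trans h2.symm)]
  choose d hd hd' using key
  refine ⟨{ desc := fun t => TypeCat.ofHom (d t), fac := ?_, uniq := ?_ }⟩
  · intro t j
    ext a
    exact (hd t _ j a rfl).symm
  · intro t m hm
    ext x
    refine hd' t x (m x) fun j a h => ?_
    rw [← h, ← hm]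
    rfl

theorem univ_presheaf {J : Type u} [SmallCategory J] {D : Type u} [SmallCategory D]
    {F : J ⥤ D ⥤ Type u} (c : Cocone F)
    (hc : IsColimit c) : IsUniversalColimit c := by
  intro F' c' α f e hα hp
  refine ⟨evaluationJointlyReflectsColimits _ fun x => ?_⟩
  exact (univ_type (((evaluation D (Type u)).obj x).mapCocone c) (isColimitOfPreserves _ hc)
    (((evaluation D (Type u)).obj x).mapCocone c') (Functor.whiskerRight α _)
      (((evaluation D (Type u)).obj x).map f) (by
        ext y
        exact ConcreteCategory.congr_hom (NatTrans.congr_app (NatTrans.congr_app e y) x) _) 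
      (hα.whiskerRight _) (fun j => (hp j).map ((evaluation D (Type u)).obj x))).some

theorem univ_sheaf {J : Type u} [SmallCategory J] {D : Type u} [SmallCategory D]
    (K : GrothendieckTopology D) {F : J ⥤ Sheaf K (Type u)} (c : Cocone F)
    (hc : IsColimit c) : IsUniversalColimit c := by
  have h := IsUniversalColimit.map_reflective (sheafificationAdjunction K (Type u))
    (univ_presheaf _ (colimit.isColimit (F ⋙ sheafToPresheaf K (Type u))))
  let i : (F ⋙ sheafToPresheaf K (Type u)) ⋙ presheafToSheaf K (Type u) ≅ F :=
    Functor.isoWhiskerLeft F (asIso (sheafificationAdjunction K (Type u)).counit) ≪≫ F.rightUnitor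
  have h2 := IsUniversalColimit.precompose_isIso i.inv h
  exact h2.of_iso (h2.isColimit.uniqueUpToIso hc)

theorem pb_fst {B : Type*} [Category B] [HasPullbacks B] {T Y : B} (s : T ⟶ Y) {U V : Over Y}
    (g : U ⟶ V) : ((Over.pullback s).map g).left ≫ pullback.fst V.hom s =
      pullback.fst U.hom s ≫ g.left := pullback.lift_fst _ _ _

theorem pb_snd {B : Type*} [Category B] [HasPullbacks B] {T Y : B} (s : T ⟶ Y) {U V : Over Y}
    (g : U ⟶ V) : ((Over.pullback s).map g).left ≫ pullback.snd V.hom s =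
      pullback.snd U.hom s := pullback.lift_snd _ _ _

theorem pb_isPullback {B : Type*} [Category B] [HasPullbacks B] {T Y : B} (s : T ⟶ Y) {U V : Over Y}
    (g : U ⟶ V) : IsPullback ((Over.pullback s).map g).left
      (pullback.fst U.hom s) (pullback.fst V.hom s) g.left := by
  refine IsPullback.flip (IsPullback.of_bot (v₂₁ := pullback.snd V.hom s) (h₃₁ := s)
    (v₂₂ := V.hom) ?_ (pb_fst s g).symm (IsPullback.of_hasPullback _ _))
  rw [pb_snd, Over.w]
  exact IsPullback.of_hasPullback _ _

theorem overPullback_preserves {D : Type u} [SmallCategory D]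
    (K : GrothendieckTopology D) {T Y : Sheaf K (Type u)} (s : T ⟶ Y) :
    PreservesColimitsOfSize.{u, u} (Over.pullback s) := by
  refine ⟨fun {I} _ => ⟨fun {G} => ⟨fun {c} hc => ?_⟩⟩⟩
  have hu := univ_sheaf K _ (isColimitOfPreserves (Over.forget Y) hc)
  let α : (G ⋙ Over.pullback s) ⋙ Over.forget T ⟶ G ⋙ Over.forget Y :=
    { app := fun i => pullback.fst (G.obj i).hom s
      naturality := fun i j g => pb_fst s (G.map g) }
  have := hu ((Over.forget T).mapCocone ((Over.pullback s).mapCocone c)) α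
    (pullback.fst c.pt.hom s) (by
      apply NatTrans.ext
      funext i
      exact (pb_fst s (c.ι.app i)).symm)
    (fun i j g => pb_isPullback s (G.map g)) (fun j => pb_isPullback s (c.ι.app j))
  exact ⟨isColimitOfReflects (Over.forget T) this.some⟩

theorem overPost_preserves {A B : Type*} [Category A] [Category B] [HasColimitsOfSize.{u, u} A] (F : A ⥤ B)
    [PreservesColimitsOfSize.{u, u} F] (X : A) :
    PreservesColimitsOfSize.{u, u} (Over.post F (X := X)) := by
  refine ⟨fun {I} _ => ⟨fun {G} => ⟨fun {c} hc => ?_⟩⟩⟩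
  have h1 : IsColimit (F.mapCocone ((Over.forget X).mapCocone c)) :=
    isColimitOfPreserves F (isColimitOfPreserves (Over.forget X) hc)
  exact ⟨isColimitOfReflects (Over.forget (F.obj X)) h1⟩

section slice
variable {A B : Type*} [Category A] [Category B] [HasPullbacks B] {X : A} {T : B}

/-- The fibre over `s : T ⟶ F X` of the functor induced by `F` on slices. -/
noncomputable def sliceFun (F : A ⥤ B) (s : T ⟶ F.obj X) : Over X ⥤ B :=
  Over.post F ⋙ Over.pullback s ⋙ Over.forget T

/-- The component of `sliceMap` at `y`. -/
noncomputable abbrev sliceApp {F G : A ⥤ B} (τ : F ⟶ G) (s : T ⟶ F.obj X) {Y : A} (y : Y ⟶ X) :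
    pullback (F.map y) s ⟶ pullback (G.map y) (s ≫ τ.app X) :=
  pullback.lift (pullback.fst (F.map y) s ≫ τ.app _) (pullback.snd (F.map y) s)
    (by rw [Category.assoc, ← τ.naturality, pullback.condition_assoc])

theorem sliceApp_fst {F G : A ⥤ B} (τ : F ⟶ G) (s : T ⟶ F.obj X) {Y : A} (y : Y ⟶ X) :
    sliceApp τ s y ≫ pullback.fst (G.map y) (s ≫ τ.app X) = pullback.fst (F.map y) s ≫ τ.app _ :=
  pullback.lift_fst _ _ _

theorem sliceApp_snd {F G : A ⥤ B} (τ : F ⟶ G) (s : T ⟶ F.obj X) {Y : A} (y : Y ⟶ X) :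
    sliceApp τ s y ≫ pullback.snd (G.map y) (s ≫ τ.app X) = pullback.snd (F.map y) s :=
  pullback.lift_snd _ _ _

theorem slicePb_w (F : A ⥤ B) (s : T ⟶ F.obj X) {Y Z : A} (y : Y ⟶ X)
    (z : Z ⟶ X) (g : Y ⟶ Z) (w : g ≫ z = y) :
    (pullback.fst (F.map y) s ≫ F.map g) ≫ F.map z = pullback.snd (F.map y) s ≫ s := by
  rw [Category.assoc, ← F.map_comp, w, pullback.condition]

/-- Functoriality of the fibres. -/
noncomputable def slicePb (F : A ⥤ B) (s : T ⟶ F.obj X) {Y Z : A} (y : Y ⟶ X)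
    (z : Z ⟶ X) (g : Y ⟶ Z) (w : g ≫ z = y) : pullback (F.map y) s ⟶ pullback (F.map z) s :=
  pullback.lift (pullback.fst (F.map y) s ≫ F.map g) (pullback.snd (F.map y) s)
    (slicePb_w F s y z g w)

theorem slicePb_fst (F : A ⥤ B) (s : T ⟶ F.obj X) {Y Z : A} (y : Y ⟶ X)
    (z : Z ⟶ X) (g : Y ⟶ Z) (w : g ≫ z = y) :
    slicePb F s y z g w ≫ pullback.fst (F.map z) s = pullback.fst (F.map y) s ≫ F.map g :=
  pullback.lift_fst _ _ _

theorem slicePb_snd (F : A ⥤ B) (s : T ⟶ F.obj X) {Y Z : A} (y : Y ⟶ X)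
    (z : Z ⟶ X) (g : Y ⟶ Z) (w : g ≫ z = y) :
    slicePb F s y z g w ≫ pullback.snd (F.map z) s = pullback.snd (F.map y) s :=
  pullback.lift_snd _ _ _

theorem sliceMap_aux {F G : A ⥤ B} (τ : F ⟶ G) (s : T ⟶ F.obj X) {Y Z : A} (y : Y ⟶ X)
    (z : Z ⟶ X) (g : Y ⟶ Z) (w : g ≫ z = y) :
    slicePb F s y z g w ≫ sliceApp τ s z =
    sliceApp τ s y ≫ slicePb G (s ≫ τ.app X) y z g w := by
  have h1 := sliceApp_fst τ s y
  have h2 := sliceApp_snd τ s y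
  have h3 := slicePb_fst F s y z g w
  apply pullback.hom_ext
  · rw [Category.assoc, sliceApp_fst, Category.assoc, slicePb_fst, reassoc_of% h3,
      reassoc_of% h1, τ.naturality]
  · rw [Category.assoc, sliceApp_snd, Category.assoc, slicePb_snd, slicePb_snd, h2]

/-- Naturality of `sliceFun`. -/
noncomputable def sliceMap {F G : A ⥤ B} (τ : F ⟶ G) (s : T ⟶ F.obj X) :
    sliceFun F s ⟶ sliceFun G (s ≫ τ.app X) where
  app Y := sliceApp τ s Y.hom
  naturality Y Z g := by
    exact sliceMap_aux τ s Y.hom Z.hom g.left (Over.w g)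

/-- Projection from the fibre of a product. -/
noncomputable def slicePr [HasBinaryProducts A] (F : A ⥤ B) (s : T ⟶ F.obj X) (Z : A) :
    (sliceFun F s).obj (Over.mk (prod.fst : X ⨯ Z ⟶ X)) ⟶ F.obj Z :=
  pullback.fst (F.map (prod.fst : X ⨯ Z ⟶ X)) s ≫ F.map prod.snd

theorem slicePr_isIso [HasFiniteLimits A] (F : A ⥤ B) [PreservesFiniteLimits F]
    (hT : IsTerminal T) (s : T ⟶ F.obj X) (Z : A) : IsIso (slicePr F s Z) := by
  have h1 : IsPullback (prod.fst : X ⨯ Z ⟶ X) prod.snd (terminal.from X) (terminal.from Z) :=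
    IsPullback.of_is_product' (prodIsProd X Z) terminalIsTerminal
  have h2 := (h1.map F)
  have h3 := (IsPullback.of_hasPullback (F.map (prod.fst : X ⨯ Z ⟶ X)) s).flip.paste_vert h2
  have : IsIso (s ≫ F.map (terminal.from X)) :=
    isIso_of_isTerminal hT (IsTerminal.isTerminalObj F _ terminalIsTerminal) _
  exact h3.isIso_snd_of_isIso

theorem sliceMap_pr [HasBinaryProducts A] {F G : A ⥤ B} (τ : F ⟶ G) (s : T ⟶ F.obj X) (Z : A) :
    (sliceMap τ s).app _ ≫ slicePr G (s ≫ τ.app X) Z = slicePr F s Z ≫ τ.app Z := by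
  change sliceApp τ s (prod.fst : X ⨯ Z ⟶ X) ≫
      pullback.fst (G.map (prod.fst : X ⨯ Z ⟶ X)) (s ≫ τ.app X) ≫ G.map prod.snd =
    (pullback.fst (F.map (prod.fst : X ⨯ Z ⟶ X)) s ≫ F.map prod.snd) ≫ τ.app Z
  have h1 := sliceApp_fst τ s (prod.fst : X ⨯ Z ⟶ X)
  rw [reassoc_of% h1, Category.assoc, τ.naturality]

theorem sliceFun_lim [HasFiniteLimits A] (F : A ⥤ B) [PreservesFiniteLimits F]
    (hT : IsTerminal T) (s : T ⟶ F.obj X) : PreservesFiniteLimits (sliceFun F s) := by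
  have : PreservesFiniteLimits (Over.forget T) :=
    inferInstanceAs (PreservesFiniteLimits (Over.equivalenceOfIsTerminal hT).functor)
  have : PreservesFiniteLimits (Over.pullback s) := inferInstance
  have : PreservesFiniteLimits (Over.pullback s ⋙ Over.forget T) := comp_preservesFiniteLimits _ _
  exact comp_preservesFiniteLimits _ _

end slice

theorem sliceFun_colim {A : Type*} [Category A] [HasColimitsOfSize.{u, u} A]
    {D : Type u} [SmallCategory D]
    (K : GrothendieckTopology D) (F : A ⥤ Sheaf K (Type u)) [PreservesColimitsOfSize.{u, u} F]
    {X : A} {T : Sheaf K (Type u)} (s : T ⟶ F.obj X) :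
    PreservesColimitsOfSize.{u, u} (sliceFun F s) := by
  have := overPost_preserves F X
  have := overPullback_preserves K s
  unfold sliceFun
  infer_instance

theorem iso_of_section {A : Type*} [Category A] [HasColimitsOfSize.{u, u} A] [HasFiniteLimits A]
    {X : A} (h : Grouplike.{u} (Over X)) {D : Type u} [SmallCategory D]
    (K : GrothendieckTopology D) (F G : A ⥤ Sheaf K (Type u)) [PreservesColimitsOfSize.{u, u} F]
    [PreservesColimitsOfSize.{u, u} G] [PreservesFiniteLimits F] [PreservesFiniteLimits G]
    (τ : F ⟶ G) {T : Sheaf K (Type u)} (hT : IsTerminal T) (s : T ⟶ F.obj X) (Z : A) :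
    IsIso (τ.app Z) := by
  have h1 := h D _ K (sliceFun F s) (sliceFun G (s ≫ τ.app X)) ⟨sliceFun_lim F hT s⟩
    ⟨sliceFun_colim K F s⟩ ⟨sliceFun_lim G hT _⟩ ⟨sliceFun_colim K G _⟩ (sliceMap τ s)
  have h2 := sliceMap_pr τ s Z
  have h3 := slicePr_isIso F hT s Z
  have h4 := slicePr_isIso G hT (s ≫ τ.app X) Z
  have h5 : IsIso (slicePr F s Z ≫ τ.app Z) := by
    rw [← h2]
    infer_instance
  exact IsIso.of_isIso_comp_left (slicePr F s Z) (τ.app Z)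

/-- Being grouplike descends along etale surjections: if `X` is an object of a
Grothendieck topos `𝒳` whose map to the terminal object is an epimorphism, and the slice
topos `𝒳/X` is grouplike, then `𝒳` is grouplike. -/
theorem statement15 {C : Type u} [SmallCategory C] (J : GrothendieckTopology C)
    (X : Sheaf J (Type u)) (hX : Epi (terminal.from X))
    (h : Grouplike.{u} (Over X)) :
    Grouplike.{u} (Sheaf J (Type u)) := by
  intro D _ K P Q ⟨hP⟩ ⟨hP'⟩ ⟨hQ⟩ ⟨hQ'⟩ τ
  let I := Σ U : D, (P.obj X).obj.obj (Opposite.op U)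
  have hcov : K.CoversTop (fun i : I => i.1) := by
    intro W
    have : Epi (P.map (terminal.from X)) := inferInstance
    rw [← Sheaf.isLocallySurjective_iff_epi] at this
    let ht : IsTerminal (P.obj (⊤_ (Sheaf J (Type u)))) :=
      IsTerminal.isTerminalObj P _ terminalIsTerminal
    have ht' := IsTerminal.isTerminalObj (sheafToPresheaf K _ ⋙ (evaluation _ _).obj (Opposite.op W)) _ ht
    let x : (P.obj (⊤_ (Sheaf J (Type u)))).obj.obj (Opposite.op W) :=
      (ht'.from PUnit) PUnit.unit
    refine K.superset_covering ?_ (Presheaf.imageSieve_mem K (P.map (terminal.from X)).hom x)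
    rintro V g ⟨t, -⟩
    exact ⟨⟨V, t⟩, ⟨𝟙 V⟩⟩
  rw [NatTrans.isIso_iff_isIso_app]
  intro Z
  refine Sheaf.isIso_of_coversTop hcov ?_
  rintro ⟨U, x⟩
  let R := K.overPullback (Type u) U
  have r1 : PreservesColimitsOfSize.{u, u} R :=
    ((Over.forget U).sheafAdjunctionCocontinuous (Type u) (K.over U) K).leftAdjoint_preservesColimits
  have r2 : PreservesFiniteLimits R := by
    infer_instance
  have p1 : PreservesFiniteLimits (P ⋙ R) := comp_preservesFiniteLimits _ _
  have p2 : PreservesFiniteLimits (Q ⋙ R) := comp_preservesFiniteLimits _ _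
  let s : (⊤_ (Sheaf (K.over U) (Type u))) ⟶ (P ⋙ R).obj X :=
    ⟨{ app := fun V => TypeCat.ofHom fun _ => (P.obj X).obj.map V.unop.hom.op x
       naturality := fun V W g => by
        ext y
        change (P.obj X).obj.map W.unop.hom.op x =
          (P.obj X).obj.map g.unop.left.op ((P.obj X).obj.map V.unop.hom.op x)
        rw [← Over.w g.unop, op_comp, Functor.map_comp]
        rfl }⟩
  have hcol : HasColimitsOfSize.{u, u} (Sheaf J (Type u)) := ⟨fun _ _ => inferInstance⟩
  exact iso_of_section h (K.over U) (P ⋙ R) (Q ⋙ R) (Functor.whiskerRight τ R)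
    terminalIsTerminal s Z
end

section
/- Call a category 𝒞 with finite limits and small colimits grouplike if for every small site (D,K) and every pair of functors P, Q : 𝒞 ⥤ Sheaf K (Type) preserving finite limits and small colimits, every natural transformation P ⟶ Q is an isomorphism. Let I be a small index type and {(C_i, J_i)}_{i ∈ I} a family of small sites such that each Grothendieck topos Sheaf J_i (Type) is grouplike. Then the product category ∏_{i ∈ I} Sheaf J_i (Type) — the underlying category of the coproduct of these topoi — is grouplike. -/
universe u

open CategoryTheory Limits

universe v w

namespace GrpLike
section pi
variable {I : Type u} {A : I → Type w} [∀ i, Category.{v} (A i)] [∀ i, HasInitial (A i)]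

/-- identity or constant initial -/
noncomputable def T (i j : I) : Decidable (i = j) → (A i ⥤ A j)
  | .isTrue h => by subst h; exact 𝟭 _
  | .isFalse _ => (Functor.const _).obj (⊥_ _)

noncomputable def tι (i j : I) (X : ∀ i, A i) : ∀ d : Decidable (i = j), (T (A := A) i j d).obj (X i) ⟶ X j
  | .isTrue h => by subst h; exact 𝟙 _
  | .isFalse _ => initial.to _

lemma tι_isIso (i : I) (X : ∀ i, A i) (d : Decidable (i = i)) : IsIso (tι i i X d) := by
  cases d with
  | isTrue h => exact (inferInstance : IsIso (𝟙 (X i)))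
  | isFalse h => exact absurd rfl h

lemma T_initial (i j : I) (h : i ≠ j) (d : Decidable (i = j)) (X : A i) :
    Nonempty (IsInitial ((T (A := A) i j d).obj X)) := by
  cases d with
  | isTrue hh => exact absurd hh h
  | isFalse h => exact ⟨initialIsInitial⟩

/-- single at i -/
noncomputable def S (i : I) : A i ⥤ (∀ j, A j) :=
  Functor.pi' fun j => T i j (Classical.propDecidable _)

noncomputable def sι (i : I) (X : ∀ i, A i) : (S i).obj (X i) ⟶ X :=
  fun j => tι i j X (Classical.propDecidable _)

instance (i : I) (X : ∀ i, A i) : IsIso (sι i X i) := tι_isIso _ _ _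

lemma S_initial {i j : I} (h : i ≠ j) (X : A i) : Nonempty (IsInitial ((S i).obj X j)) :=
  T_initial i j h _ X

lemma tι_nat (i j : I) {X Y : ∀ i, A i} (f : X ⟶ Y) (d) :
    (T i j d).map (f i) ≫ tι i j Y d = tι i j X d ≫ f j := by
  cases d with
  | isTrue hh => subst hh; simp [T, tι]
  | isFalse h => exact initialIsInitial.hom_ext _ _

lemma sι_nat (i : I) {X Y : ∀ i, A i} (f : X ⟶ Y) :
    (S i).map (f i) ≫ sι i Y = sι i X ≫ f := by
  funext j; exact tι_nat i j f _

noncomputable def sColim (X : ∀ i, A i) :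
    IsColimit (Cofan.mk X (fun i => sι i X)) :=
  Cofan.IsColimit.mk _ (fun s j => inv (sι j X j) ≫ s.inj j j)
    (by
      intro s i
      funext j
      change sι i X j ≫ inv (sι j X j) ≫ s.inj j j = s.inj i j
      by_cases h : i = j
      · subst h; simp
      · exact (S_initial h (X i)).some.hom_ext _ _)
    (by
      intro s m hm
      funext j
      rw [IsIso.eq_inv_comp]
      exact congr_fun (hm j) j)

lemma T_colim {K : Type*} [Category K] (i j : I) (d) :
    PreservesColimitsOfShape K (T (A := A) i j d) := by
  cases d with
  | isTrue hh => subst hh; dsimp [T]; infer_instance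
  | isFalse h =>
    exact ⟨fun {F} => ⟨fun {c} hc => ⟨⟨fun s => initial.to _,
      fun s j => initialIsInitial.hom_ext _ _,
      fun s m _ => initialIsInitial.hom_ext _ _⟩⟩⟩⟩

lemma T_lim {K : Type*} [Category K] [IsConnected K] (i j : I) (d) :
    PreservesLimitsOfShape K (T (A := A) i j d) := by
  cases d with
  | isTrue hh => subst hh; dsimp [T]; infer_instance
  | isFalse h =>
    exact ⟨fun {F} => ⟨fun {c} hc => ⟨isLimitConstCone K (⊥_ (A j))⟩⟩⟩

instance S_colim {K : Type*} [Category K] (i : I) : PreservesColimitsOfShape K (S (A := A) i) where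
  preservesColimit {F} := ⟨fun {c} hc => ⟨by
    have := fun j => T_colim (A := A) (K := K) i j (Classical.propDecidable _)
    have P := fun j => isColimitOfPreserves (T (A := A) i j (Classical.propDecidable _)) hc
    let ev (s : Cocone (F ⋙ S (A := A) i)) (j : I) :
        Cocone (F ⋙ T (A := A) i j (Classical.propDecidable _)) :=
      { pt := s.pt j
        ι := { app := fun k => s.ι.app k j
               naturality := fun _ _ f => congr_fun (s.ι.naturality f) j } }
    exact
      { desc := fun s j => (P j).desc (ev s j)
        fac := fun s k => funext fun j => (P j).fac (ev s j) k
        uniq := fun s m w => funext fun j =>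
          (P j).uniq (ev s j) (m j) fun k => congr_fun (w k) j }⟩⟩

instance S_lim {K : Type*} [Category K] [IsConnected K] (i : I) :
    PreservesLimitsOfShape K (S (A := A) i) where
  preservesLimit {F} := ⟨fun {c} hc => ⟨by
    have := fun j => T_lim (A := A) (K := K) i j (Classical.propDecidable _)
    have P := fun j => isLimitOfPreserves (T (A := A) i j (Classical.propDecidable _)) hc
    let ev (s : Cone (F ⋙ S (A := A) i)) (j : I) :
        Cone (F ⋙ T (A := A) i j (Classical.propDecidable _)) :=
      { pt := s.pt j
        π := { app := fun k => s.π.app k j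
               naturality := fun _ _ f => congr_fun (s.π.naturality f) j } }
    exact
      { lift := fun s j => (P j).lift (ev s j)
        fac := fun s k => funext fun j => (P j).fac (ev s j) k
        uniq := fun s m w => funext fun j =>
          (P j).uniq (ev s j) (m j) fun k => congr_fun (w k) j }⟩⟩

variable [∀ i, HasTerminal (A i)]

noncomputable def co (i : I) : ∀ j, A j := fun j => 
  haveI := Classical.propDecidable (i = j)
  if i = j then ⊥_ _ else ⊤_ _

noncomputable def topObj : ∀ j : I, A j := fun _ => ⊤_ _

noncomputable def topTerm : IsTerminal (topObj (A := A)) :=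
  IsTerminal.ofUniqueHom (fun _ _ => terminal.from _) (fun _ _ => by
    funext j; exact terminalIsTerminal.hom_ext _ _)

lemma coColim (i : I) : Nonempty (IsColimit (BinaryCofan.mk (sι i (topObj (A := A)))
    (topTerm.from (co i)))) := by
  have h1 : IsInitial (co (A := A) i i) := by
    simp only [co, if_true]; exact initialIsInitial
  have h2 : ∀ j, i ≠ j → IsIso (topTerm.from (co (A := A) i) j) := by
    intro j hj
    have : IsTerminal (co (A := A) i j) := by
      simp only [co, if_neg hj]; exact terminalIsTerminal
    exact isIso_of_isTerminal this terminalIsTerminal _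
  classical
  let D : ∀ {Z : ∀ j, A j} (_ : (S i).obj (topObj (A := A) i) ⟶ Z) (_ : co i ⟶ Z),
      ∀ j, topObj j ⟶ Z j := fun {Z} f g j =>
    if h : i = j then by subst h; exact inv (sι i topObj i) ≫ f i
      else (haveI := h2 j h; inv (topTerm.from (co (A := A) i) j) ≫ g j)
  refine ⟨BinaryCofan.IsColimit.mk _ (fun {Z} f g => D f g) ?_ ?_ ?_⟩
  · intro Z f g
    funext j
    by_cases h : i = j
    · subst h
      change sι i topObj i ≫ D f g i = _
      simp [D]
    · exact (S_initial h _).some.hom_ext _ _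
  · intro Z f g
    funext j
    by_cases h : i = j
    · subst h; exact h1.hom_ext _ _
    · have := h2 j h
      change topTerm.from (co i) j ≫ D f g j = _
      simp [D, h]
  · intro Z f g m hl hr
    change topObj ⟶ Z at m
    funext j
    by_cases h : i = j
    · subst h
      have := congr_fun hl i
      change sι i topObj i ≫ _ = _ at this
      change _ = D f g i
      simp [D, ← this]
    · have := h2 j h
      have := congr_fun hr j
      change topTerm.from (co i) j ≫ _ = _ at this
      change _ = D f g j
      simp [D, ← this, h]
end pi
section restr
variable {D : Type u} [SmallCategory D] (K : GrothendieckTopology D) (p : ObjectProperty D)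

lemma lcd (hp : ∀ ⦃X Y : D⦄ (_ : X ⟶ Y), p Y → p X) : p.ι.LocallyCoverDense K where
  functorPushforward_functorPullback_mem X T := by
    convert! T.2
    ext Z f
    constructor
    · rintro ⟨W, g, h, hg, rfl⟩
      exact T.1.downward_closed hg _
    · intro hf
      exact ⟨⟨Z, hp f X.2⟩, ObjectProperty.homMk f, 𝟙 _, hf, by simp⟩

lemma cont (hp : ∀ ⦃X Y : D⦄ (_ : X ⟶ Y), p Y → p X) :
    p.ι.IsContinuous (p.ι.restrictedTopology K) K := by
  have := lcd K p hp
  exact Functor.isContinuous_of_coverPreserving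
    (compatiblePreservingOfDownwardsClosed _ _ (fun {c d} f => ⟨⟨d, hp f c.2⟩, Iso.refl _⟩))
    (p.ι.coverPreserving_restrictedTopology K)

/-- Restriction functor to a downward closed full subcategory. -/
lemma restr_exists (hp : ∀ ⦃X Y : D⦄ (_ : X ⟶ Y), p Y → p X) :
    ∃ (KK : GrothendieckTopology p.FullSubcategory) (R : Sheaf K (Type u) ⥤ Sheaf KK (Type u)),
      PreservesFiniteLimits R ∧ PreservesColimitsOfSize.{u, u} R ∧
      (∀ (U : Sheaf K (Type u)), (∀ d, p d → Nonempty (Unique (U.obj.obj (.op d)))) →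
        Nonempty (IsTerminal (R.obj U))) ∧
      (∀ (U F G : Sheaf K (Type u)) (_ : F ⟶ U) (_ : G ⟶ U) (f : F ⟶ G),
        (∀ d, Nonempty (U.obj.obj (.op d)) → p d) → IsIso (R.map f) → IsIso f) := by
  have := lcd K p hp
  have := cont K p hp
  refine ⟨p.ι.restrictedTopology K, p.ι.sheafPushforwardContinuous (Type u) _ K, ?_, ?_, ?_, ?_⟩
  · have := (p.ι.sheafAdjunctionContinuous (Type u) (p.ι.restrictedTopology K) K).rightAdjoint_preservesLimits
    infer_instance
  · exact (p.ι.sheafAdjunctionCocontinuous (Type u) (p.ι.restrictedTopology K) K).leftAdjoint_preservesColimits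
  · intro U hU
    refine ⟨IsTerminal.ofUniqueHom (fun X => ⟨{
        app := fun d => ↾ fun _ => (hU d.unop.1 d.unop.2).some.default
        naturality := ?_ }⟩) ?_⟩
    · intro d e f
      ext x
      exact (hU e.unop.1 e.unop.2).some.instSubsingleton.elim _ _
    · intro X m
      apply ObjectProperty.hom_ext
      ext d x
      exact (hU d.unop.1 d.unop.2).some.instSubsingleton.elim _ _
  · intro U F G a b f hU hf
    have h1 : IsIso f.hom := by
      rw [NatTrans.isIso_iff_isIso_app]
      intro d
      by_cases hd : p d.unop
      · have h2 : IsIso ((sheafToPresheaf _ _).map ((p.ι.sheafPushforwardContinuous (Type u) (p.ι.restrictedTopology K) K).map f)) := inferInstance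
        rw [NatTrans.isIso_iff_isIso_app] at h2
        exact h2 (.op ⟨d.unop, hd⟩)
      · rw [isIso_iff_bijective]
        refine ⟨fun x => ?_, fun y => ?_⟩
        · exact absurd (hU _ ⟨a.hom.app d x⟩) hd
        · exact absurd (hU _ ⟨b.hom.app d y⟩) hd
    have : IsIso ((sheafToPresheaf _ _).map f) := h1
    exact isIso_of_reflects_iso f (sheafToPresheaf _ _)
end restr

lemma isIso_of_cofan {I : Type u} {A : I → Type w} [∀ i, Category.{v} (A i)]
    [∀ i, HasInitial (A i)] {E : Type*} [Category E] (P Q : (∀ i, A i) ⥤ E)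
    [PreservesColimitsOfShape (Discrete I) P] [PreservesColimitsOfShape (Discrete I) Q]
    (τ : P ⟶ Q) (X : ∀ i, A i) (h : ∀ i, IsIso (τ.app ((S i).obj (X i)))) :
    IsIso (τ.app X) := by
  let c := Cofan.mk X (fun i => sι i X)
  have hP := isColimitOfPreserves P (sColim X)
  have hQ := isColimitOfPreserves Q (sColim X)
  let F := Discrete.functor fun i => (S i).obj (X i)
  have : ∀ j, IsIso ((Functor.whiskerLeft F τ).app j) := fun ⟨j⟩ => h j
  have : IsIso (Functor.whiskerLeft F τ) := NatIso.isIso_of_isIso_app _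
  let e := IsColimit.coconePointsIsoOfNatIso hP hQ (asIso (Functor.whiskerLeft F τ))
  have he : τ.app X = e.hom := by
    refine hP.hom_ext fun ⟨j⟩ => ?_
    have := IsColimit.comp_coconePointsIsoOfNatIso_hom hP hQ (asIso (Functor.whiskerLeft F τ)) ⟨j⟩
    refine Eq.trans ?_ this.symm
    exact τ.naturality (sι j X)
  rw [he]; infer_instance

instance hasInitialSheaf {C : Type u} [SmallCategory C] (J : GrothendieckTopology C) :
    HasInitial (Sheaf J (Type u)) := by
  have : FinitaryExtensive (Sheaf J (Type u)) := SheafOfTypes.finitary_extensive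
  have : HasFiniteCoproducts (Sheaf J (Type u)) := FinitaryExtensive.hasFiniteCoproducts
  exact hasColimitsOfShape_discrete _ _

end GrpLike

open GrpLike in
/-- Grouplike topoi are closed under coproducts: if each topos `Sheaf (J i) (Type u)` in
an `I`-indexed family is grouplike, then so is the product of their underlying
categories, which underlies the coproduct topos. -/
theorem statement16 (I : Type u) (Cf : I → Type u) [∀ i, SmallCategory (Cf i)]
    (J : ∀ i, GrothendieckTopology (Cf i))
    (h : ∀ i, Grouplike.{u} (Sheaf (J i) (Type u))) :
    Grouplike.{u} (∀ i, Sheaf (J i) (Type u)) := by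
  intro D _ K P Q ⟨hP⟩ ⟨hPc⟩ ⟨hQ⟩ ⟨hQc⟩ τ
  have hP0 : PreservesColimitsOfSize.{0, 0} P := preservesColimitsOfSize_shrink P
  have hQ0 : PreservesColimitsOfSize.{0, 0} Q := preservesColimitsOfSize_shrink Q
  have tP := IsTerminal.isTerminalObj P _ (topTerm (A := fun i => Sheaf (J i) (Type u)))
  have tQ := IsTerminal.isTerminalObj Q _ (topTerm (A := fun i => Sheaf (J i) (Type u)))
  have hX : ∀ X, IsIso (τ.app X) := by
    intro X
    refine isIso_of_cofan P Q τ X fun i => ?_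
    let top := topObj (A := fun i => Sheaf (J i) (Type u))
    let Si := S (A := fun i => Sheaf (J i) (Type u)) i
    let e := Si.obj (top i)
    have cP := mapIsColimitOfPreservesOfIsColimit P _ _ (coColim (A := fun i => Sheaf (J i) (Type u)) i).some
    have cQ := mapIsColimitOfPreservesOfIsColimit Q _ _ (coColim (A := fun i => Sheaf (J i) (Type u)) i).some
    have mono : Mono (P.map (sι i top)) := FinitaryExtensive.mono_inl_of_isColimit cP
    have iso : IsIso (τ.app e) := by
      have pb : IsPullback (P.map (sι i top)) (τ.app e) (τ.app top) (Q.map (sι i top)) := (((BinaryCofan.isVanKampen_iff _).1 (FinitaryExtensive.vanKampen _ cQ)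
        (BinaryCofan.mk (P.map (sι i topObj)) (P.map (topTerm.from (co i)))) (τ.app e) (τ.app _) (τ.app top) (τ.naturality _).symm
        (τ.naturality _).symm).1 ⟨cP⟩).1
      have : IsIso (τ.app top) := isIso_of_isTerminal tP tQ _
      exact pb.isIso_snd_of_isIso
    let p : ObjectProperty D := fun d => Nonempty ((P.obj e).obj.obj (.op d))
    have hp : ∀ ⦃X Y : D⦄ (_ : X ⟶ Y), p Y → p X := fun X Y f ⟨y⟩ => ⟨(P.obj e).obj.map f.op y⟩
    obtain ⟨KK, R, hR, hRc, hT, hI⟩ := restr_exists K p hp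
    have uni : ∀ d, p d → Nonempty (Unique ((P.obj e).obj.obj (.op d))) := by
      rintro d ⟨x⟩
      let ev := sheafToPresheaf K (Type u) ⋙ (evaluation _ _).obj (.op d)
      have t := IsTerminal.isTerminalObj ev _ tP
      have m : Mono (ev.map (P.map (sι i top))) := inferInstance
      rw [mono_iff_injective] at m
      refine ⟨⟨⟨x⟩, fun y => m ?_⟩⟩
      have := Types.isTerminalEquivUnique _ t
      exact Subsingleton.elim _ _
    have t1 := (hT _ uni).some
    have t2 : IsTerminal (R.obj (Q.obj e)) := t1.ofIso (R.mapIso (asIso (τ.app e)))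
    have fl : ∀ (F : (∀ i, Sheaf (J i) (Type u)) ⥤ Sheaf K (Type u)) (_ : PreservesFiniteLimits F)
        (_ : IsTerminal (R.obj (F.obj e))), PreservesFiniteLimits (Si ⋙ F ⋙ R) := by
      intro F _ t
      have : PreservesLimitsOfShape WalkingCospan (Si ⋙ F ⋙ R) := inferInstance
      have : PreservesLimitsOfShape (Discrete.{0} PEmpty) (Si ⋙ F ⋙ R) := by
        have : PreservesLimit (Functor.empty.{0} _) (Si ⋙ F ⋙ R) :=
          preservesTerminal_of_iso _ (t.uniqueUpToIso terminalIsTerminal)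
        exact preservesLimitsOfShape_pempty_of_preservesTerminal _
      exact preservesFiniteLimits_of_preservesTerminal_and_pullbacks _
    have fc : ∀ (F : (∀ i, Sheaf (J i) (Type u)) ⥤ Sheaf K (Type u))
        (_ : PreservesColimitsOfSize.{u, u} F), PreservesColimitsOfSize.{u, u} (Si ⋙ F ⋙ R) := by
      intro F _
      exact ⟨inferInstance⟩
    have key := h i p.FullSubcategory inferInstance KK (Si ⋙ P ⋙ R) (Si ⋙ Q ⋙ R)
      ⟨fl P hP t1⟩ ⟨fc P hPc⟩ ⟨fl Q hQ t2⟩ ⟨fc Q hQc⟩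
      (Functor.whiskerLeft Si (Functor.whiskerRight τ R))
    have keyX : IsIso (R.map (τ.app ((S i).obj (X i)))) :=
      (NatTrans.isIso_iff_isIso_app _).1 key (X i)
    let ei : Q.obj e ⟶ P.obj e := inv (τ.app e)
    exact hI (P.obj e) _ _ (P.map ((S i).map (terminal.from _)))
      (Q.map ((S i).map (terminal.from _)) ≫ ei) _ (fun d hd => hd) keyX
  exact NatIso.isIso_of_isIso_app τ
end
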